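/- Let p ∈ [1, ∞]. For every m×m Hermitian matrix Z and every density matrix S of rank at most r, ‖π_{S_m}(Z) − S‖_p ≤ min( 2^{3/p+1} r^{1/p} ‖Z − S‖_∞ , 2 ‖Z − S‖_∞^{1−1/p} ). -/

import Mathlib

open scoped BigOperators ENNReal
open MeasureTheory ProbabilityTheory Matrix
open scoped ComplexOrder

noncomputable section

abbrev Mat (m : ℕ) := Matrix (Fin m) (Fin m) ℂ

namespace QST

variable {m : ℕ}

/-- Hilbert–Schmidt (Frobenius) norm `‖A‖₂`. -/
def frob (A : Mat m) : ℝ := Real.sqrt (∑ i, ∑ j, ‖A i j‖ ^ 2)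

/-- Hilbert–Schmidt inner product `⟨A,B⟩ = Re tr(A B*)`. -/
def hsInner (A B : Mat m) : ℝ := (Matrix.trace (A * Bᴴ)).re

/-- Eigenvalues of a Hermitian matrix (junk value `0` otherwise). -/
def eigs (A : Mat m) : Fin m → ℝ :=
  if h : A.IsHermitian then h.eigenvalues else 0

/-- Operator (spectral) norm of a Hermitian matrix: the largest absolute value
of an eigenvalue. -/
def opNorm (A : Mat m) : ℝ := ⨆ i, |eigs A i|

/-- Schatten `p`-norm, `p ∈ [1,∞]`. -/
def schatten (p : ℝ≥0∞) (A : Mat m) : ℝ :=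
  if p = ∞ then opNorm A
  else (∑ i, |eigs A i| ^ p.toReal) ^ (1 / p.toReal)

/-- A density matrix: positive semidefinite (hence Hermitian) with unit trace. -/
def IsDensity (A : Mat m) : Prop := A.PosSemidef ∧ A.trace = 1

/-- The set `𝒮_m` of density matrices. -/
def Densities (m : ℕ) : Set (Mat m) := {A | IsDensity A}

/-- The set `𝒮_{m,δ} = {(1-δ) S + δ I/m : S ∈ 𝒮_m}`. -/
def DensitiesReg (m : ℕ) (δ : ℝ) : Set (Mat m) :=
  {A | ∃ S, IsDensity S ∧ A = (1 - δ) • S + (δ / m) • (1 : Mat m)}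

/-- `P` is the Hilbert–Schmidt projection of `Z` onto the set `C`. -/
def IsProjOn (C : Set (Mat m)) (Z P : Mat m) : Prop :=
  P ∈ C ∧ ∀ S ∈ C, frob (Z - P) ≤ frob (Z - S)

/-- Functional calculus for Hermitian matrices via the spectral decomposition
(junk value `0` for non-Hermitian matrices). -/
def hermApply (f : ℝ → ℝ) (A : Mat m) : Mat m :=
  if h : A.IsHermitian then
    (h.eigenvectorUnitary : Mat m) *
      Matrix.diagonal (fun i => (f (h.eigenvalues i) : ℂ)) *
        (star (h.eigenvectorUnitary : Mat m))
  else 0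

/-- Quantum relative entropy `K(S₁‖S₂) = tr(S₁ log S₁ - S₁ log S₂)`; the convention
`0 log 0 = 0` is automatic since `Real.log 0 = 0`. -/
def relEntropy (S₁ S₂ : Mat m) : ℝ :=
  (Matrix.trace (S₁ * hermApply Real.log S₁ - S₁ * hermApply Real.log S₂)).re

/-- Squared Bures distance `H²(S₁,S₂) = 2 - 2 tr √(√S₁ S₂ √S₁)`. -/
def bures2 (S₁ S₂ : Mat m) : ℝ :=
  2 - 2 * (Matrix.trace (hermApply Real.sqrt
      (hermApply Real.sqrt S₁ * S₂ * hermApply Real.sqrt S₁))).re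

/-- The probability simplex `Δ_m ⊂ ℝ^m`. -/
def simplex (m : ℕ) : Set (Fin m → ℝ) := {u | (∀ j, 0 ≤ u j) ∧ ∑ j, u j = 1}

/-- Euclidean norm on `ℝ^m`. -/
def e2 (x : Fin m → ℝ) : ℝ := Real.sqrt (∑ j, x j ^ 2)

/-- Supremum norm on `ℝ^m`. -/
def linf (x : Fin m → ℝ) : ℝ := ⨆ j, |x j|

/-- `v` is the Euclidean projection of `z` onto the simplex `Δ_m`. -/
def IsProjSimplex (z v : Fin m → ℝ) : Prop :=
  v ∈ simplex m ∧ ∀ u ∈ simplex m, e2 (z - v) ≤ e2 (z - u)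

/-- `E` is an orthonormal basis of the `m²`-dimensional real inner product space `ℍ_m`
of Hermitian `m×m` matrices (an orthonormal family of `m²` Hermitian matrices is
automatically a basis). -/
def IsONBasis (E : Fin (m ^ 2) → Mat m) : Prop :=
  (∀ k, (E k).IsHermitian) ∧
    ∀ k l, (Matrix.trace (E k * (E l)ᴴ)).re = if k = l then 1 else 0


/-- The real part of the quadratic form `x ↦ x* A x`. -/
def quad (A : Mat m) (x : Fin m → ℂ) : ℝ := (star x ⬝ᵥ A *ᵥ x).re

lemma quad_add (A B : Mat m) (x : Fin m → ℂ) : quad (A + B) x = quad A x + quad B x := by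
  simp [quad, add_mulVec, dotProduct_add]

lemma quad_sub (A B : Mat m) (x : Fin m → ℂ) : quad (A - B) x = quad A x - quad B x := by
  simp [quad, sub_mulVec, dotProduct_sub]

lemma quad_smul_one (c : ℝ) {x : Fin m → ℂ} (hx : star x ⬝ᵥ x = 1) :
    quad (c • (1 : Mat m)) x = c := by
  simp [quad, smul_mulVec, dotProduct_smul, hx]

lemma quad_eq_of_mulVec_eq_smul {A : Mat m} {c : ℝ} {x : Fin m → ℂ} (hx : star x ⬝ᵥ x = 1)
    (h : A *ᵥ x = c • x) : quad A x = c := by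
  simp [quad, h, dotProduct_smul, hx]

lemma quad_nonneg {A : Mat m} (hA : A.PosSemidef) (x : Fin m → ℂ) : 0 ≤ quad A x :=
  hA.re_dotProduct_nonneg x

lemma star_dotProduct_eigenvectorBasis {A : Mat m} (hA : A.IsHermitian) (i j : Fin m) :
    star (hA.eigenvectorBasis i).ofLp ⬝ᵥ (hA.eigenvectorBasis j).ofLp = if i = j then 1 else 0 := by
  rw [← orthonormal_iff_ite.mp hA.eigenvectorBasis.orthonormal i j,
    EuclideanSpace.inner_eq_star_dotProduct, dotProduct_comm]

lemma star_dotProduct_eigenvectorBasis_self {A : Mat m} (hA : A.IsHermitian) (i : Fin m) :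
    star (hA.eigenvectorBasis i).ofLp ⬝ᵥ (hA.eigenvectorBasis i).ofLp = 1 := by
  simp [star_dotProduct_eigenvectorBasis]

lemma quad_eigenvectorBasis {A : Mat m} (hA : A.IsHermitian) (i : Fin m) :
    quad A (hA.eigenvectorBasis i).ofLp = hA.eigenvalues i :=
  (hA.eigenvalues_eq i).symm

lemma sum_quad_eigenvectorBasis {A : Mat m} (hA : A.IsHermitian) (B : Mat m) :
    ∑ i, quad B (hA.eigenvectorBasis i).ofLp = B.trace.re := by
  have h : B.trace = (star (hA.eigenvectorUnitary : Mat m) * B * hA.eigenvectorUnitary).trace := by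
    rw [trace_mul_comm, ← mul_assoc, Unitary.mul_star_self_of_mem hA.eigenvectorUnitary.2, one_mul]
  rw [h, trace, Complex.re_sum]
  refine Finset.sum_congr rfl fun i _ => ?_
  rw [quad, diag_apply, mul_assoc, mul_apply]
  simp [dotProduct, mulVec, star_apply, mul_apply]

lemma sum_eigenvalues {A : Mat m} (hA : A.IsHermitian) : ∑ i, hA.eigenvalues i = A.trace.re := by
  simp [hA.trace_eq_sum_eigenvalues]

lemma posSemidef_of_eigenvector {A : Mat m} (hA : A.IsHermitian)
    (h : ∀ (x : Fin m → ℂ) (c : ℝ), star x ⬝ᵥ x = 1 → A *ᵥ x = c • x → 0 ≤ c) :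
    A.PosSemidef :=
  hA.posSemidef_iff_eigenvalues_nonneg.mpr fun i =>
    h _ _ (star_dotProduct_eigenvectorBasis_self hA i) (hA.mulVec_eigenvectorBasis i)

lemma isHermitian_smul_one (c : ℝ) : (c • (1 : Mat m)).IsHermitian := by
  simp [IsHermitian, conjTranspose_smul]

lemma opNorm_nonneg (A : Mat m) : 0 ≤ opNorm A := Real.iSup_nonneg fun _ => abs_nonneg _

lemma abs_eigenvalues_le_opNorm {A : Mat m} (hA : A.IsHermitian) (i : Fin m) :
    |hA.eigenvalues i| ≤ opNorm A := by
  have h := le_ciSup (Set.finite_range fun i => |eigs A i|).bddAbove i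
  simpa only [opNorm, eigs, dif_pos hA] using h

lemma posSemidef_smul_one_add_smul {A : Mat m} (hA : A.IsHermitian) {c e : ℝ}
    (h : ∀ i, 0 ≤ c + e * hA.eigenvalues i) : (c • (1 : Mat m) + e • A).PosSemidef := by
  have hU := Unitary.mul_star_self_of_mem hA.eigenvectorUnitary.2
  have hdiag : c • (1 : Mat m) + e • A = (hA.eigenvectorUnitary : Mat m) *
      diagonal (fun i => ((c + e * hA.eigenvalues i : ℝ) : ℂ)) *
        (hA.eigenvectorUnitary : Mat m)ᴴ := by
    have hD : diagonal (fun i => ((c + e * hA.eigenvalues i : ℝ) : ℂ)) =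
        c • (1 : Mat m) + e • diagonal (RCLike.ofReal ∘ hA.eigenvalues) := by
      ext i j
      by_cases hij : i = j <;> simp [one_apply, hij]
    rw [hD, ← star_eq_conjTranspose, mul_add, add_mul, Matrix.mul_smul, Matrix.mul_smul,
      Matrix.smul_mul, Matrix.smul_mul, mul_one, hU]
    conv_lhs => rw [hA.spectral_theorem, Unitary.conjStarAlgAut_apply]
  rw [hdiag]
  refine PosSemidef.mul_mul_conjTranspose_same (posSemidef_diagonal_iff.mpr fun i => ?_) _
  exact_mod_cast h i

lemma abs_quad_le_opNorm {A : Mat m} (hA : A.IsHermitian) {x : Fin m → ℂ}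
    (hx : star x ⬝ᵥ x = 1) : |quad A x| ≤ opNorm A := by
  have h i := abs_le.mp (abs_eigenvalues_le_opNorm hA i)
  have h1 := quad_nonneg (posSemidef_smul_one_add_smul hA (c := opNorm A) (e := 1)
    fun i => by linarith [h i]) x
  have h2 := quad_nonneg (posSemidef_smul_one_add_smul hA (c := opNorm A) (e := -1)
    fun i => by linarith [h i]) x
  rw [one_smul, quad_add, quad_smul_one _ hx] at h1
  rw [neg_one_smul, ← sub_eq_add_neg, quad_sub, quad_smul_one _ hx] at h2
  exact abs_le.mpr ⟨by linarith, by linarith⟩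

open scoped MatrixOrder Matrix.Norms.L2Operator in
lemma mul_eq_zero_of_re_trace {A B : Mat m} (hA : A.PosSemidef) (hB : B.PosSemidef)
    (h : (A * B).trace.re = 0) : A * B = 0 := by
  obtain ⟨C, rfl⟩ := CStarAlgebra.nonneg_iff_eq_star_mul_self.mp hA.nonneg
  obtain ⟨D, rfl⟩ := CStarAlgebra.nonneg_iff_eq_star_mul_self.mp hB.nonneg
  rw [star_eq_conjTranspose, star_eq_conjTranspose] at *
  have h1 : (Cᴴ * C * (Dᴴ * D)).trace = ((C * Dᴴ)ᴴ * (C * Dᴴ)).trace := by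
    rw [← mul_assoc, trace_mul_comm, conjTranspose_mul, conjTranspose_conjTranspose]
    simp only [mul_assoc]
  have h2 : ((C * Dᴴ)ᴴ * (C * Dᴴ)).trace = 0 := by
    have h3 := (posSemidef_conjTranspose_mul_self (C * Dᴴ)).trace_nonneg
    rw [h1] at h
    exact Complex.ext h (Complex.nonneg_iff.mp h3).2.symm
  rw [trace_conjTranspose_mul_self_eq_zero_iff] at h2
  rw [mul_assoc, ← mul_assoc C, h2, zero_mul, mul_zero]

lemma frob_sq (A : Mat m) : frob A ^ 2 = hsInner A A := by
  rw [frob, Real.sq_sqrt (by positivity)]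
  simp only [hsInner, trace, diag_apply, mul_apply, conjTranspose_apply, Complex.re_sum]
  refine Finset.sum_congr rfl fun i _ => Finset.sum_congr rfl fun j _ => ?_
  simp [Complex.sq_norm, Complex.normSq_apply]

lemma hsInner_comm (A B : Mat m) : hsInner A B = hsInner B A := by
  rw [hsInner, hsInner, ← Complex.conj_re, ← Complex.star_def, ← trace_conjTranspose]
  simp

lemma frob_sub_smul_sq (A B : Mat m) (e : ℝ) :
    frob (A - e • B) ^ 2 = frob A ^ 2 - 2 * e * hsInner A B + e ^ 2 * frob B ^ 2 := by
  have h := hsInner_comm B A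
  simp only [frob_sq]
  simp only [hsInner, conjTranspose_sub, conjTranspose_smul, sub_mul, mul_sub, trace_sub, smul_mul,
    Matrix.mul_smul, trace_smul, Complex.sub_re, Complex.smul_re, star_trivial, smul_eq_mul] at h ⊢
  rw [h]
  ring

lemma hsInner_sub_le_zero {Z P Q : Mat m} (hP : IsProjOn (Densities m) Z P) (hQ : IsDensity Q) :
    hsInner (Z - P) (Q - P) ≤ 0 := by
  by_contra! hpos
  set a := hsInner (Z - P) (Q - P)
  set b := frob (Q - P) ^ 2
  have hb : 0 ≤ b := sq_nonneg _
  have key : ∀ e : ℝ, 0 < e → e ≤ 1 → 2 * a ≤ e * b := by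
    intro e he he1
    have hQ' : (1 - e) • P + e • Q ∈ Densities m := by
      refine ⟨(hP.1.1.smul (sub_nonneg.mpr he1)).add (hQ.1.smul he.le), ?_⟩
      simp [trace_add, trace_smul, hP.1.2, hQ.2]
    have h := hP.2 _ hQ'
    have h' : Z - ((1 - e) • P + e • Q) = (Z - P) - e • (Q - P) := by module
    rw [h'] at h
    have h2 := pow_le_pow_left₀ (Real.sqrt_nonneg _) h 2
    rw [← frob, frob_sub_smul_sq] at h2
    have : 0 ≤ e * (e * b - 2 * a) := by
      change frob (Z - P) ^ 2 ≤ frob (Z - P) ^ 2 - 2 * e * a + e ^ 2 * b at h2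
      linarith
    linarith [nonneg_of_mul_nonneg_right this he]
  have h1 := key 1 one_pos le_rfl
  have hb' : 0 < b := by linarith
  have h2 := key (a / b) (by positivity) (by rw [div_le_one hb']; linarith)
  rw [div_mul_cancel₀ _ hb'.ne'] at h2
  linarith

lemma IsDensity.isHermitian {A : Mat m} (hA : IsDensity A) : A.IsHermitian := hA.1.1

lemma isDensity_vecMulVec {x : Fin m → ℂ} (hx : star x ⬝ᵥ x = 1) :
    IsDensity (vecMulVec x (star x)) :=
  ⟨posSemidef_vecMulVec_self_star x, by rw [trace_vecMulVec, dotProduct_comm, hx]⟩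

lemma hsInner_vecMulVec (A : Mat m) (x : Fin m → ℂ) :
    hsInner A (vecMulVec x (star x)) = quad A x := by
  rw [hsInner, (posSemidef_vecMulVec_self_star x).1.eq, mul_vecMulVec, trace_vecMulVec,
    dotProduct_comm, quad]

lemma quad_le_hsInner {Z P : Mat m} (hP : IsProjOn (Densities m) Z P) {x : Fin m → ℂ}
    (hx : star x ⬝ᵥ x = 1) : quad (Z - P) x ≤ hsInner (Z - P) P := by
  have h := hsInner_sub_le_zero hP (isDensity_vecMulVec hx)
  have h' : hsInner (Z - P) (vecMulVec x (star x) - P) =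
      quad (Z - P) x - hsInner (Z - P) P := by
    rw [← hsInner_vecMulVec]
    simp [hsInner, mul_sub]
  linarith

/-- Complementary slackness for the projection onto the density matrices. -/
lemma exists_multiplier {Z P : Mat m} (hZ : Z.IsHermitian) (hP : IsProjOn (Densities m) Z P) :
    ∃ t : ℝ, (t • (1 : Mat m) - (Z - P)).PosSemidef ∧ (t • (1 : Mat m) - (Z - P)) * P = 0 := by
  have hPd : IsDensity P := hP.1
  have hpsd : (hsInner (Z - P) P • (1 : Mat m) - (Z - P)).PosSemidef := by
    refine posSemidef_of_eigenvector
      ((isHermitian_smul_one _).sub (hZ.sub hPd.isHermitian)) fun x c hx hc => ?_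
    rw [← quad_eq_of_mulVec_eq_smul hx hc, quad_sub, quad_smul_one _ hx]
    linarith [quad_le_hsInner hP hx]
  refine ⟨_, hpsd, mul_eq_zero_of_re_trace hpsd hPd.1 ?_⟩
  rw [sub_mul, trace_sub, Matrix.smul_mul, one_mul, trace_smul, hPd.2, Complex.sub_re,
    Complex.smul_re, hsInner, hPd.isHermitian.eq]
  simp

lemma multiplier_le {Z P S : Mat m} {t d : ℝ} (hP : IsDensity P) (hS : IsDensity S)
    (hd : ∀ x : Fin m → ℂ, star x ⬝ᵥ x = 1 → |quad (Z - S) x| ≤ d)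
    (ht : (t • (1 : Mat m) - (Z - P)) * P = 0) : t ≤ d := by
  by_contra! hlt
  have hPh := hP.isHermitian
  have hpos (i) (hi : 0 < hPh.eigenvalues i) :
      hPh.eigenvalues i < quad S (hPh.eigenvectorBasis i).ofLp := by
    set x := (hPh.eigenvectorBasis i).ofLp with hxdef
    have hx : star x ⬝ᵥ x = 1 := star_dotProduct_eigenvectorBasis_self hPh i
    have h0 : hPh.eigenvalues i • ((t • (1 : Mat m) - (Z - P)) *ᵥ x) = 0 := by
      rw [← mulVec_smul, ← hPh.mulVec_eigenvectorBasis, mulVec_mulVec, ht, zero_mulVec]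
    have h1 : quad (t • (1 : Mat m) - (Z - P)) x = 0 := by
      rw [quad, (smul_eq_zero.mp h0).resolve_left hi.ne', dotProduct_zero, Complex.zero_re]
    have h2 : quad P x = hPh.eigenvalues i := quad_eigenvectorBasis hPh i
    have h3 := (abs_le.mp (hd x hx)).2
    rw [quad_sub] at h3
    rw [quad_sub, quad_sub, quad_smul_one _ hx] at h1
    linarith
  have hle (i) : hPh.eigenvalues i ≤ quad S (hPh.eigenvectorBasis i).ofLp := by
    rcases (hP.1.eigenvalues_nonneg i).lt_or_eq with h | h
    · exact (hpos i h).le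
    · exact h ▸ quad_nonneg hS.1 _
  have hsum : ∑ i, hPh.eigenvalues i = 1 := by simp [sum_eigenvalues, hP.2]
  have hsum' : ∑ i, quad S (hPh.eigenvectorBasis i).ofLp = 1 := by
    simp [sum_quad_eigenvectorBasis, hS.2]
  obtain ⟨i, -, hi⟩ : ∃ i ∈ Finset.univ, 0 < hPh.eigenvalues i :=
    Finset.exists_lt_of_sum_lt (by simp [hsum])
  have := Finset.sum_lt_sum (fun i _ => hle i) ⟨i, Finset.mem_univ i, hpos i hi⟩
  linarith

lemma neg_le_multiplier {Z P S : Mat m} {t d : ℝ} (hP : IsDensity P) (hS : IsDensity S)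
    (hd : ∀ x : Fin m → ℂ, star x ⬝ᵥ x = 1 → |quad (Z - S) x| ≤ d)
    (ht : (t • (1 : Mat m) - (Z - P)).PosSemidef) : -d ≤ t := by
  by_contra! hlt
  have hPh := hP.isHermitian
  have hlt' (i) : quad S (hPh.eigenvectorBasis i).ofLp < quad P (hPh.eigenvectorBasis i).ofLp := by
    set x := (hPh.eigenvectorBasis i).ofLp
    have hx : star x ⬝ᵥ x = 1 := star_dotProduct_eigenvectorBasis_self hPh i
    have h1 := quad_nonneg ht x
    have h3 := (abs_le.mp (hd x hx)).1
    rw [quad_sub] at h3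
    rw [quad_sub, quad_sub, quad_smul_one _ hx] at h1
    linarith
  have hne : (Finset.univ : Finset (Fin m)).Nonempty := by
    by_contra! h
    have h1 := hP.2
    simp [trace, h] at h1
  have := Finset.sum_lt_sum_of_nonempty hne fun i _ => hlt' i
  simp [sum_quad_eigenvectorBasis, hS.2, hP.2] at this

lemma abs_quad_sub_proj_le {Z P S : Mat m} {d : ℝ} (hZ : Z.IsHermitian) (hS : IsDensity S)
    (hP : IsProjOn (Densities m) Z P)
    (hd : ∀ x : Fin m → ℂ, star x ⬝ᵥ x = 1 → |quad (Z - S) x| ≤ d)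
    {x : Fin m → ℂ} (hx : star x ⬝ᵥ x = 1) : |quad (Z - P) x| ≤ d := by
  obtain ⟨t, ht, ht0⟩ := exists_multiplier hZ hP
  have hPd : IsDensity P := hP.1
  have hW := hZ.sub hPd.isHermitian
  have hcomm : P * (t • (1 : Mat m) - (Z - P)) = 0 := by
    have h := congrArg conjTranspose ht0
    rwa [conjTranspose_mul, ht.1.eq, hPd.isHermitian.eq, conjTranspose_zero] at h
  have hlow : (d • (1 : Mat m) + (Z - P)).PosSemidef := by
    refine posSemidef_of_eigenvector ((isHermitian_smul_one _).add hW) fun y c hy hc => ?_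
    have hN : (t • (1 : Mat m) - (Z - P)) *ᵥ y = (t + d - c) • y := by
      have h : t • (1 : Mat m) - (Z - P) =
          (t + d) • (1 : Mat m) - (d • (1 : Mat m) + (Z - P)) := by module
      rw [h, sub_mulVec, hc, smul_mulVec, one_mulVec, ← sub_smul]
    have hPy : (t + d - c) • (P *ᵥ y) = 0 := by
      rw [← mulVec_smul, ← hN, mulVec_mulVec, hcomm, zero_mulVec]
    rcases smul_eq_zero.mp hPy with h | h
    · linarith [neg_le_multiplier hPd hS hd ht]
    · have h1 : quad P y = 0 := by simp [quad, h]
      have h2 := quad_eq_of_mulVec_eq_smul hy hc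
      have h3 := (abs_le.mp (hd y hy)).1
      have h4 := quad_nonneg hS.1 y
      rw [quad_sub] at h3
      rw [quad_add, quad_sub, quad_smul_one _ hy] at h2
      linarith
  have h1 := quad_nonneg hlow x
  have h2 := quad_nonneg ht x
  rw [quad_add, quad_smul_one _ hx] at h1
  rw [quad_sub, quad_smul_one _ hx] at h2
  exact abs_le.mpr ⟨by linarith, by linarith [multiplier_le hPd hS hd ht0]⟩

lemma abs_eigenvalues_proj_sub_le {Z P S : Mat m} (hZ : Z.IsHermitian) (hS : IsDensity S)
    (hP : IsProjOn (Densities m) Z P) (hD : (P - S).IsHermitian) (i : Fin m) :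
    |hD.eigenvalues i| ≤ 2 * opNorm (Z - S) := by
  have hd (x : Fin m → ℂ) (hx : star x ⬝ᵥ x = 1) : |quad (Z - S) x| ≤ opNorm (Z - S) :=
    abs_quad_le_opNorm (hZ.sub hS.isHermitian) hx
  have hx := star_dotProduct_eigenvectorBasis_self hD i
  have h1 := abs_quad_sub_proj_le hZ hS hP hd hx
  have h2 := hd _ hx
  rw [← quad_eigenvectorBasis hD i]
  rw [quad_sub, abs_le] at *
  constructor <;> linarith

/-- Subtracting `S` from a positive semidefinite matrix creates at most `rank S` negative
eigenvalues. -/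
lemma card_eigenvalues_neg_le {P S : Mat m} (hP : P.PosSemidef) (hD : (P - S).IsHermitian) :
    (Finset.univ.filter fun i => hD.eigenvalues i < 0).card ≤ S.rank := by
  rw [← Fintype.card_subtype]
  let v : {i // hD.eigenvalues i < 0} → LinearMap.range S.mulVecLin := fun i =>
    ⟨S *ᵥ (hD.eigenvectorBasis i).ofLp, ⟨_, rfl⟩⟩
  have hv : LinearIndependent ℂ v := by
    rw [Fintype.linearIndependent_iff]
    intro g hg i
    set x : Fin m → ℂ := ∑ j, g j • (hD.eigenvectorBasis j).ofLp with hx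
    have hSx : S *ᵥ x = 0 := by
      have h := congrArg Subtype.val hg
      simpa [v, hx, mulVec_sum, mulVec_smul] using h
    have hDx : quad (P - S) x = ∑ j, ‖g j‖ ^ 2 * hD.eigenvalues j := by
      have h1 : (P - S) *ᵥ x =
          ∑ j, (g j * (hD.eigenvalues j : ℂ)) • (hD.eigenvectorBasis j).ofLp := by
        simp only [hx, mulVec_sum, mulVec_smul, hD.mulVec_eigenvectorBasis, mul_smul,
          Complex.coe_smul]
      rw [quad, h1, hx]
      simp only [star_sum, star_smul, sum_dotProduct, dotProduct_sum, smul_dotProduct,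
        dotProduct_smul, star_dotProduct_eigenvectorBasis, Subtype.val_inj, smul_eq_mul, mul_ite,
        mul_one, mul_zero, Complex.re_sum]
      refine Finset.sum_congr rfl fun j _ => ?_
      rw [← Complex.normSq_eq_norm_sq, Complex.normSq_apply]
      simp
      ring
    have hnn : 0 ≤ quad (P - S) x := by
      have h1 : quad S x = 0 := by simp [quad, hSx]
      rw [quad_sub, h1, sub_zero]
      exact quad_nonneg hP x
    have hle (j : {i // hD.eigenvalues i < 0}) : ‖g j‖ ^ 2 * hD.eigenvalues j ≤ 0 :=
      mul_nonpos_of_nonneg_of_nonpos (sq_nonneg _) j.2.le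
    have hzero := (Finset.sum_eq_zero_iff_of_nonpos fun j _ => hle j).mp
      (le_antisymm (Finset.sum_nonpos fun j _ => hle j) (hDx ▸ hnn)) i (Finset.mem_univ i)
    simpa [i.2.ne] using hzero
  exact hv.fintype_card_le_finrank

lemma sum_abs_eq_of_sum_eq_zero {ι : Type*} [Fintype ι] {a : ι → ℝ} (h : ∑ i, a i = 0) :
    ∑ i, |a i| = 2 * ∑ i with a i < 0, -a i := by
  have h1 : ∑ i, |a i| = 2 * (∑ i with a i < 0, -a i) + ∑ i, a i := by
    rw [Finset.sum_filter, Finset.mul_sum, ← Finset.sum_add_distrib]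
    refine Finset.sum_congr rfl fun i _ => ?_
    split_ifs with hi
    · rw [abs_of_neg hi]; ring
    · rw [abs_of_nonneg (not_lt.mp hi)]; ring
  rw [h1, h, add_zero]

lemma sum_abs_eigenvalues_sub_le_two {P S : Mat m} (hP : IsDensity P) (hS : IsDensity S)
    (hD : (P - S).IsHermitian) : ∑ i, |hD.eigenvalues i| ≤ 2 := by
  have hneg (i) : |hD.eigenvalues i| ≤
      quad P (hD.eigenvectorBasis i).ofLp + quad S (hD.eigenvectorBasis i).ofLp := by
    have h1 := quad_nonneg hP.1 (hD.eigenvectorBasis i).ofLp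
    have h2 := quad_nonneg hS.1 (hD.eigenvectorBasis i).ofLp
    rw [← quad_eigenvectorBasis hD i, quad_sub, abs_le]
    constructor <;> linarith
  refine (Finset.sum_le_sum fun i _ => hneg i).trans ?_
  rw [Finset.sum_add_distrib, sum_quad_eigenvectorBasis, sum_quad_eigenvectorBasis, hP.2, hS.2]
  norm_num

lemma sum_abs_eigenvalues_sub_le_rank {P S : Mat m} {r : ℕ} {c : ℝ} (hP : IsDensity P)
    (hS : IsDensity S) (hrank : S.rank ≤ r) (hD : (P - S).IsHermitian) (hc : 0 ≤ c)
    (h : ∀ i, |hD.eigenvalues i| ≤ c) : ∑ i, |hD.eigenvalues i| ≤ 2 * (r * c) := by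
  rw [sum_abs_eq_of_sum_eq_zero (by simp [sum_eigenvalues, trace_sub, hP.2, hS.2])]
  have h1 := Finset.sum_le_card_nsmul (Finset.univ.filter fun i => hD.eigenvalues i < 0)
    (fun i => -hD.eigenvalues i) c fun i _ => (neg_le_abs _).trans (h i)
  have h2 : ((Finset.univ.filter fun i => hD.eigenvalues i < 0).card : ℝ) ≤ r := by
    exact_mod_cast (card_eigenvalues_neg_le hP.1 hD).trans hrank
  rw [nsmul_eq_mul] at h1
  linarith [mul_le_mul_of_nonneg_right h2 hc]

lemma rpow_sum_abs_le {ι : Type*} [Fintype ι] {a : ι → ℝ} {c K q : ℝ} (hq : 1 ≤ q)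
    (h : ∀ i, |a i| ≤ c) (hK : ∑ i, |a i| ≤ K) (hc : 0 ≤ c) :
    (∑ i, |a i| ^ q) ^ (1 / q) ≤ K ^ (1 / q) * c ^ (1 - 1 / q) := by
  have hq0 : 0 < q := by linarith
  have hK0 : 0 ≤ K := (Finset.sum_nonneg fun i _ => abs_nonneg (a i)).trans hK
  have h1 : ∑ i, |a i| ^ q ≤ K * c ^ (q - 1) := by
    refine le_trans ?_ (mul_le_mul_of_nonneg_right hK (Real.rpow_nonneg hc _))
    rw [Finset.sum_mul]
    refine Finset.sum_le_sum fun i _ => ?_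
    calc |a i| ^ q = |a i| ^ (1 + (q - 1)) := by ring_nf
      _ = |a i| * |a i| ^ (q - 1) := by
        rw [Real.rpow_add' (abs_nonneg _) (by linarith), Real.rpow_one]
      _ ≤ |a i| * c ^ (q - 1) := by
        have := Real.rpow_le_rpow (abs_nonneg _) (h i) (sub_nonneg.mpr hq)
        gcongr
  calc (∑ i, |a i| ^ q) ^ (1 / q) ≤ (K * c ^ (q - 1)) ^ (1 / q) :=
        Real.rpow_le_rpow (Finset.sum_nonneg fun i _ => by positivity) h1 (by positivity)
    _ = K ^ (1 / q) * c ^ (1 - 1 / q) := by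
        rw [Real.mul_rpow hK0 (by positivity), ← Real.rpow_mul hc]
        congr 2
        field_simp

lemma schatten_le_interpolate {A : Mat m} (hA : A.IsHermitian) {p : ℝ≥0∞} (hp : 1 ≤ p) {c K : ℝ}
    (h : ∀ i, |hA.eigenvalues i| ≤ c) (hK : ∑ i, |hA.eigenvalues i| ≤ K) (hc : 0 ≤ c) :
    schatten p A ≤ K ^ (1 / p).toReal * c ^ (1 - (1 / p).toReal) := by
  by_cases hp' : p = ∞
  · have h1 : opNorm A ≤ c := by
      refine Real.iSup_le (fun i => ?_) hc
      simpa only [eigs, dif_pos hA] using h i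
    simpa [schatten, hp'] using h1
  · have hq : 1 ≤ p.toReal := by
      simpa using ENNReal.toReal_mono hp' hp
    have hq' : (1 / p).toReal = 1 / p.toReal := by simp
    rw [schatten, if_neg hp', hq']
    simpa only [eigs, dif_pos hA] using rpow_sum_abs_le hq h hK hc

/-- Schatten `p`-norm bound for the projection of `Z` onto the density
matrices, in terms of the operator norm distance from `Z` to a density matrix `S` of
rank at most `r`. -/
theorem stmt1 {m r : ℕ} (p : ℝ≥0∞) (hp : 1 ≤ p)
    (Z : Mat m) (hZ : Z.IsHermitian)
    (S : Mat m) (hS : IsDensity S) (hrank : S.rank ≤ r)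
    (P : Mat m) (hP : IsProjOn (Densities m) Z P) :
    schatten p (P - S) ≤
      min ((2 : ℝ) ^ (3 * (1 / p).toReal + 1) * (r : ℝ) ^ (1 / p).toReal * opNorm (Z - S))
        (2 * opNorm (Z - S) ^ (1 - (1 / p).toReal)) := by
  have hPd : IsDensity P := hP.1
  have hD : (P - S).IsHermitian := hPd.isHermitian.sub hS.isHermitian
  have hd := opNorm_nonneg (Z - S)
  have hc : 0 ≤ 2 * opNorm (Z - S) := by positivity
  have hle := abs_eigenvalues_proj_sub_le hZ hS hP hD
  have hrr := schatten_le_interpolate hD hp hle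
    (sum_abs_eigenvalues_sub_le_rank hPd hS hrank hD hc hle) hc
  have h2 := schatten_le_interpolate hD hp hle (sum_abs_eigenvalues_sub_le_two hPd hS hD) hc
  set d := opNorm (Z - S)
  set s := (1 / p).toReal
  have hs : 0 ≤ s := ENNReal.toReal_nonneg
  refine le_min (hrr.trans ?_) (h2.trans_eq ?_)
  · calc (2 * (r * (2 * d))) ^ s * (2 * d) ^ (1 - s)
        = 2 ^ s * r ^ s * ((2 * d) ^ s * (2 * d) ^ (1 - s)) := by
          rw [Real.mul_rpow zero_le_two (by positivity), Real.mul_rpow (by positivity) hc]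
          ring
      _ = 2 ^ (s + 1) * r ^ s * d := by
          rw [← Real.rpow_add' hc (by norm_num), add_sub_cancel, Real.rpow_one,
            Real.rpow_add zero_lt_two, Real.rpow_one]
          ring
      _ ≤ 2 ^ (3 * s + 1) * r ^ s * d := by
          gcongr
          · norm_num
          · linarith
  · rw [Real.mul_rpow zero_le_two hd, ← mul_assoc, ← Real.rpow_add zero_lt_two, add_sub_cancel,
      Real.rpow_one]

end QST
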